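/- arXiv:1611.08752 — 2 statements merged into one kernel-verified Lean document; each statement's English description precedes it below -/
import Mathlib

section
/- There exists a universal constant C > 0 such that for all integers m ≥ 1, n ≥ 2 and every matrix A ∈ ℝ^{m×n} whose columns A^j satisfy ‖A^j‖_2 ≤ 1 for all j = 1,…,n, there exists a coloring x ∈ {-1,1}^n with ‖Ax‖_∞ ≤ C·√(log n). -/
open scoped InnerProductSpace

namespace Komlos

/-! ### Scalar inequalities -/

/-- The two point moment generating function `cosh s + z sinh s`. -/
noncomputable def M (s z : ℝ) : ℝ := Real.cosh s + z * Real.sinh s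

lemma M_ge (s z : ℝ) (hz : |z| ≤ 1) : Real.exp (s * z) ≤ M s z := by
  obtain ⟨h1, h2⟩ := abs_le.1 hz
  have h := convexOn_exp.2 (Set.mem_univ s) (Set.mem_univ (-s))
    (by linarith : 0 ≤ (1 + z) / 2) (by linarith : 0 ≤ (1 - z) / 2) (by ring)
  simp only [smul_eq_mul] at h
  have e1 : (1 + z) / 2 * s + (1 - z) / 2 * -s = s * z := by ring
  rw [e1] at h
  unfold M
  rw [Real.cosh_eq, Real.sinh_eq]
  linarith

lemma M_pos (s z : ℝ) (hz : |z| ≤ 1) : 0 < M s z := (Real.exp_pos _).trans_le (M_ge s z hz)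

lemma M_le (s z : ℝ) (hz : |z| ≤ 1) : M s z ≤ Real.exp (s * z + s ^ 2) := by
  have h1 := M_ge (-s) z hz
  have h2 : M s z * M (-s) z ≤ Real.exp (s ^ 2) := by
    have h3 : M s z * M (-s) z ≤ Real.cosh s ^ 2 := by
      unfold M
      rw [Real.cosh_neg, Real.sinh_neg]
      nlinarith [sq_nonneg (z * Real.sinh s)]
    have h4 : Real.cosh s ^ 2 ≤ Real.exp (s ^ 2 / 2) ^ 2 :=
      pow_le_pow_left₀ (Real.cosh_pos s).le (Real.cosh_le_exp_half_sq s) 2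
    have h5 : Real.exp (s ^ 2 / 2) ^ 2 = Real.exp (s ^ 2) := by
      rw [← Real.exp_nat_mul]; congr 1; push_cast; ring
    linarith
  have h6 : M s z * Real.exp (-s * z) ≤ Real.exp (s ^ 2) :=
    (mul_le_mul_of_nonneg_left h1 (M_pos s z hz).le).trans h2
  calc M s z = (M s z * Real.exp (-s * z)) * Real.exp (s * z) := by
        rw [mul_assoc, ← Real.exp_add]; simp
    _ ≤ Real.exp (s ^ 2) * Real.exp (s * z) :=
        mul_le_mul_of_nonneg_right h6 (Real.exp_pos _).le
    _ = _ := by rw [← Real.exp_add]; congr 1; ring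

lemma sinh_le_mul_cosh {s : ℝ} (hs : 0 ≤ s) : Real.sinh s ≤ s * Real.cosh s := by
  have hm : MonotoneOn (fun t : ℝ => t * Real.cosh t - Real.sinh t) (Set.Ici 0) := by
    apply monotoneOn_of_deriv_nonneg (convex_Ici 0)
    · fun_prop
    · fun_prop
    · intro t ht
      simp only [interior_Ici, Set.mem_Ioi] at ht
      have hd : HasDerivAt (fun t : ℝ => t * Real.cosh t - Real.sinh t)
          (1 * Real.cosh t + t * Real.sinh t - Real.cosh t) t :=
        ((hasDerivAt_id t).mul (Real.hasDerivAt_cosh t)).sub (Real.hasDerivAt_sinh t)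
      rw [hd.deriv]
      have := mul_nonneg ht.le (Real.sinh_nonneg_iff.2 ht.le)
      linarith
  have := hm (Set.mem_Ici.2 le_rfl) (Set.mem_Ici.2 hs) hs
  simp at this
  linarith

lemma abs_sinh_le (s : ℝ) : |Real.sinh s| ≤ |s| * Real.cosh s := by
  rw [Real.abs_sinh, ← Real.cosh_abs s]
  exact sinh_le_mul_cosh (abs_nonneg s)

lemma M_add (s e z : ℝ) (hz : |z| ≤ 1) :
    M (s + e) z * Real.exp (-((s + e) * z)) ≤
      M s z * Real.exp (-(s * z)) * Real.exp (2 * |s * e| + e ^ 2) := by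
  have hM := M_pos s z hz
  obtain ⟨hz1, hz2⟩ := abs_le.1 hz
  set w := (Real.sinh s + z * Real.cosh s) / M s z with hw
  have hwM : w * M s z = Real.sinh s + z * Real.cosh s := by
    rw [hw]; field_simp
  have hw1 : |w| ≤ 1 := by
    rw [hw, abs_div, abs_of_pos hM, div_le_one hM, abs_le]
    unfold M
    have e1 := Real.cosh_sub_sinh s
    have e2 := Real.cosh_add_sinh s
    have p1 := Real.exp_pos s
    have p2 := Real.exp_pos (-s)
    constructor <;> nlinarith
  have hfac : M (s + e) z = M s z * M e w := by
    have : M s z * M e w = M s z * Real.cosh e + (w * M s z) * Real.sinh e := by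
      unfold M; ring
    rw [this, hwM]
    unfold M
    rw [Real.cosh_add, Real.sinh_add]; ring
  have hwz : |w - z| ≤ 2 * |s| := by
    have h1 : (w - z) * M s z = Real.sinh s * (1 - z ^ 2) := by
      rw [sub_mul, hwM]; unfold M; ring
    by_cases hz0 : |z| = 1
    · have : z ^ 2 = 1 := by rw [← sq_abs, hz0]; norm_num
      rw [this] at h1
      have : w - z = 0 := by
        rcases mul_eq_zero.1 (h1.trans (by ring : Real.sinh s * (1 - 1) = 0)) with h | h
        · exact h
        · exact absurd h hM.ne'
      rw [this]; simp
    have hz3 : 0 < 1 - |z| := by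
      have := lt_of_le_of_ne hz hz0
      linarith
    have hc := Real.cosh_pos s
    have h2 : (1 - |z|) * Real.cosh s ≤ M s z := by
      have h3 : -(|z| * |Real.sinh s|) ≤ z * Real.sinh s := by
        rw [← abs_mul]; exact neg_abs_le _
      have h4 : |Real.sinh s| ≤ Real.cosh s := by
        rw [abs_le]
        constructor
        · have := Real.cosh_add_sinh s; have := Real.exp_pos s; linarith
        · have := Real.cosh_sub_sinh s; have := Real.exp_pos (-s); linarith
      have h5 := mul_le_mul_of_nonneg_left h4 (abs_nonneg z)
      unfold M
      linarith
    have h6 : |w - z| * M s z = |Real.sinh s| * ((1 - |z|) * (1 + |z|)) := by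
      have h6' : |w - z| * M s z = |(w - z) * M s z| := by rw [abs_mul, abs_of_pos hM]
      rw [h6', h1, abs_mul]
      congr 1
      rw [abs_of_nonneg (by nlinarith), ← sq_abs z]; ring
    have h7 : |w - z| * ((1 - |z|) * Real.cosh s) ≤
        (2 * |s|) * ((1 - |z|) * Real.cosh s) := by
      calc |w - z| * ((1 - |z|) * Real.cosh s) ≤ |w - z| * M s z :=
            mul_le_mul_of_nonneg_left h2 (abs_nonneg _)
        _ = |Real.sinh s| * ((1 - |z|) * (1 + |z|)) := h6
        _ ≤ (|s| * Real.cosh s) * ((1 - |z|) * 2) := by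
            apply mul_le_mul (abs_sinh_le s) _ (by positivity) (by positivity)
            exact mul_le_mul_of_nonneg_left (by linarith) hz3.le
        _ = _ := by ring
    exact le_of_mul_le_mul_right h7 (by positivity)
  have h8 := M_le e w hw1
  rw [hfac]
  calc M s z * M e w * Real.exp (-((s + e) * z))
      ≤ M s z * Real.exp (e * w + e ^ 2) * Real.exp (-((s + e) * z)) := by gcongr
    _ = M s z * Real.exp (-(s * z)) * Real.exp (e * (w - z) + e ^ 2) := by
        rw [mul_assoc, mul_assoc, ← Real.exp_add, ← Real.exp_add]; congr 2; ring
    _ ≤ _ := by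
        refine mul_le_mul_of_nonneg_left (Real.exp_le_exp.2 ?_) (by positivity)
        refine add_le_add ?_ le_rfl
        calc e * (w - z) ≤ |e * (w - z)| := le_abs_self _
          _ = |e| * |w - z| := abs_mul _ _
          _ ≤ |e| * (2 * |s|) := by gcongr
          _ = 2 * |s * e| := by rw [abs_mul]; ring

lemma quad_ineq (s e q r : ℝ) (hq : 0 ≤ q) (hr : 0 ≤ r) (hqr : q + r ≤ 1)
    (hs : q = 0 → s = 0) (he : r = 0 → e = 0) :
    2 * |s * e| + e ^ 2 + (s + e) ^ 2 / (q + r) ≤ 4 * (e ^ 2 / r) + s ^ 2 / q := by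
  rcases hr.eq_or_lt with h0 | hr
  · rw [he h0.symm, ← h0]; simp
  rcases hq.eq_or_lt with h0 | hq
  · rw [hs h0.symm, ← h0]; simp
    have : e ^ 2 ≤ e ^ 2 / r := by
      rw [le_div_iff₀ hr]; nlinarith [sq_nonneg e]
    have : 0 ≤ e ^ 2 / r := by positivity
    linarith
  obtain ⟨σ, rfl⟩ : ∃ σ, s = σ * q := ⟨s / q, by field_simp⟩
  obtain ⟨ρ, rfl⟩ : ∃ ρ, e = ρ * r := ⟨e / r, by field_simp⟩
  have e1 : (ρ * r) ^ 2 / r = ρ ^ 2 * r := by field_simp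
  have e2 : (σ * q) ^ 2 / q = σ ^ 2 * q := by field_simp
  have e3 : (σ * q + ρ * r) ^ 2 / (q + r) =
      σ ^ 2 * q + ρ ^ 2 * r - (σ - ρ) ^ 2 * (q * r) / (q + r) := by field_simp; ring
  have e4 : (σ - ρ) ^ 2 * (q * r) ≤ (σ - ρ) ^ 2 * (q * r) / (q + r) := by
    rw [le_div_iff₀ (by positivity)]
    have : 0 ≤ (σ - ρ) ^ 2 * (q * r) := by positivity
    nlinarith
  have e5 : |σ * q * (ρ * r)| = |σ * ρ| * (q * r) := by
    rw [show σ * q * (ρ * r) = σ * ρ * (q * r) by ring, abs_mul,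
      abs_of_pos (by positivity : 0 < q * r)]
  rw [e1, e2, e3, e5]
  have e6 : 2 * |σ * ρ| ≤ (σ - ρ) ^ 2 + 3 * ρ ^ 2 := by
    rcases abs_cases (σ * ρ) with ⟨h, _⟩ | ⟨h, _⟩ <;> rw [h]
    · nlinarith [sq_nonneg (σ - 2 * ρ)]
    · nlinarith [sq_nonneg σ, sq_nonneg ρ]
  have e7 : 2 * |σ * ρ| * (q * r) ≤ ((σ - ρ) ^ 2 + 3 * ρ ^ 2) * (q * r) :=
    mul_le_mul_of_nonneg_right e6 (by positivity)
  have e8 : ρ ^ 2 * r * (3 * q + r) ≤ ρ ^ 2 * r * 3 :=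
    mul_le_mul_of_nonneg_left (by linarith) (by positivity)
  nlinarith

/-! ### Projections -/

section proj
variable {E : Type*} [NormedAddCommGroup E] [InnerProductSpace ℝ E] [FiniteDimensional ℝ E]

lemma proj_ineq (U W : Submodule ℝ E) (hWU : W ≤ U) (d θ : E) (hd : d ∈ U)
    (hdW : ∀ w ∈ W, ⟪w, d⟫_ℝ = 0) :
    ‖W.starProjection θ‖ ^ 2 + ⟪θ, d⟫_ℝ ^ 2 / ‖d‖ ^ 2 ≤ ‖U.starProjection θ‖ ^ 2 := by
  set f := U.starProjection θ - W.starProjection θ with hf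
  have hWm : W.starProjection θ ∈ W := W.starProjection_apply_mem θ
  have h1 : ⟪f, W.starProjection θ⟫_ℝ = 0 := by
    have a := Submodule.starProjection_inner_eq_zero (K := W) θ _ hWm
    have b := Submodule.starProjection_inner_eq_zero (K := U) θ _ (hWU hWm)
    rw [inner_sub_left] at a b
    rw [hf, inner_sub_left]; linarith
  have h2 : ⟪θ, d⟫_ℝ = ⟪f, d⟫_ℝ := by
    have b := Submodule.starProjection_inner_eq_zero (K := U) θ _ hd
    rw [inner_sub_left] at b
    rw [hf, inner_sub_left, hdW _ hWm]; linarith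
  have h3 : ‖U.starProjection θ‖ ^ 2 = ‖W.starProjection θ‖ ^ 2 + ‖f‖ ^ 2 := by
    have : U.starProjection θ = f + W.starProjection θ := by rw [hf]; abel
    rw [this, norm_add_sq_real, h1]; ring
  rw [h3, h2]
  gcongr
  apply div_le_of_le_mul₀ (by positivity) (by positivity)
  have := abs_real_inner_le_norm f d
  rw [← mul_pow, ← sq_abs]
  gcongr

end proj

/-! ### Hitting the boundary of the cube -/

lemma hit {ι : Type*} (S : Finset ι) (x u : ι → ℝ) (hx : ∀ i ∈ S, |x i| ≤ 1)
    (p : ι) (hp : p ∈ S) (hu : u p ≠ 0) :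
    ∃ t : ℝ, 0 ≤ t ∧ (∀ i ∈ S, |x i + t * u i| ≤ 1) ∧ ∃ i ∈ S, |x i + t * u i| = 1 := by
  have key : ∀ i, ∀ t : ℝ, |x i| ≤ 1 → u i ≠ 0 →
      t = (1 - x i * (SignType.sign (u i) : ℝ)) / |u i| → 0 ≤ t ∧ |x i + t * u i| = 1 ∧
      ∀ t', 0 ≤ t' → t' ≤ t → |x i + t' * u i| ≤ 1 := by
    intro i t hxi hui ht
    obtain ⟨a, b⟩ := abs_le.1 hxi
    rcases lt_or_gt_of_ne hui with h | h
    · rw [sign_neg h, abs_of_neg h] at ht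
      simp only [SignType.coe_neg_one] at ht
      have ht' : t * u i = -(1 + x i) := by rw [ht]; field_simp; ring
      have h0 : 0 ≤ t := by rw [ht]; apply div_nonneg <;> linarith
      refine ⟨h0, by rw [ht']; ring_nf; simp, fun t' h1 h2 => ?_⟩
      rw [abs_le]; constructor <;> nlinarith
    · rw [sign_pos h, abs_of_pos h] at ht
      simp only [SignType.coe_one] at ht
      have ht' : t * u i = 1 - x i := by rw [ht]; field_simp
      have h0 : 0 ≤ t := by rw [ht]; apply div_nonneg <;> linarith
      refine ⟨h0, by rw [ht']; ring_nf; simp, fun t' h1 h2 => ?_⟩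
      rw [abs_le]; constructor <;> nlinarith
  classical
  obtain ⟨k, hk, hmin⟩ := Finset.exists_min_image (S.filter (fun i => u i ≠ 0))
    (fun i => (1 - x i * (SignType.sign (u i) : ℝ)) / |u i|) ⟨p, by simp [hp, hu]⟩
  rw [Finset.mem_filter] at hk
  obtain ⟨h0, h1, -⟩ := key k _ (hx k hk.1) hk.2 rfl
  refine ⟨_, h0, fun i hi => ?_, k, hk.1, h1⟩
  by_cases hui : u i = 0
  · rw [hui]; simpa using hx i hi
  · exact (key i _ (hx i hi) hui rfl).2.2 _ h0 (hmin i (by simp [hi, hui]))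

/-! ### The Gram-Schmidt walk -/

section walk
variable {ι κ E : Type*} [DecidableEq ι] [Fintype κ]
  [NormedAddCommGroup E] [InnerProductSpace ℝ E] [FiniteDimensional ℝ E]

/-- Span of the alive vectors. -/
def W (v : ι → E) (A : Finset ι) : Submodule ℝ E := Submodule.span ℝ (v '' (A : Set ι))

/-- Residual of `v p`. -/
noncomputable def res (v : ι → E) (A : Finset ι) (p : ι) : E :=
  v p - (W v A).starProjection (v p)

/-- No-pivot claim. -/
def NP (v : ι → E) (θ : κ → E) (A : Finset ι) : Prop :=
  ∀ x : ι → ℝ, (∀ i ∈ A, |x i| ≤ 1) → ∀ w : κ → ℝ, (∀ j, 0 ≤ w j) →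
    ∃ y : ι → ℝ, (∀ i ∈ A, y i = 1 ∨ y i = -1) ∧
      ∑ j, w j * Real.exp ⟪θ j, ∑ i ∈ A, (y i - x i) • v i⟫_ℝ ≤
        ∑ j, w j * Real.exp (4 * ‖(W v A).starProjection (θ j)‖ ^ 2)

/-- Potential of one test vector in the pivot phase. -/
noncomputable def pot (v : ι → E) (A : Finset ι) (p : ι) (z : ℝ) (θ : E) : ℝ :=
  Real.exp (4 * ‖(W v A).starProjection θ‖ ^ 2 + ⟪θ, res v A p⟫_ℝ ^ 2 / ‖res v A p‖ ^ 2) *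
    (M ⟪θ, res v A p⟫_ℝ z * Real.exp (-(⟪θ, res v A p⟫_ℝ * z)))

/-- Conclusion of the pivot claim. -/
def PPc (v : ι → E) (θ : κ → E) (A : Finset ι) (p : ι) (x : ι → ℝ) (w : κ → ℝ) : Prop :=
    ∃ y : ι → ℝ, (∀ i ∈ insert p A, y i = 1 ∨ y i = -1) ∧
      ∑ j, w j * Real.exp ⟪θ j, ∑ i ∈ insert p A, (y i - x i) • v i⟫_ℝ ≤
        ∑ j, w j * pot v A p (x p) (θ j)

/-- Pivot claim. -/
def PP (v : ι → E) (θ : κ → E) (A : Finset ι) (p : ι) : Prop :=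
  ∀ x : ι → ℝ, (∀ i ∈ insert p A, |x i| ≤ 1) → ∀ w : κ → ℝ, (∀ j, 0 ≤ w j) →
    PPc v θ A p x w

lemma res_orth (v : ι → E) (A : Finset ι) (p : ι) : ∀ w ∈ W v A, ⟪w, res v A p⟫_ℝ = 0 := by
  intro w hw
  rw [real_inner_comm]
  exact Submodule.starProjection_inner_eq_zero _ _ hw

lemma W_mono (v : ι → E) {A B : Finset ι} (h : A ⊆ B) : W v A ≤ W v B :=
  Submodule.span_mono (Set.image_mono (by exact_mod_cast h))

lemma mem_W (v : ι → E) {A : Finset ι} {i : ι} (h : i ∈ A) : v i ∈ W v A :=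
  Submodule.subset_span ⟨i, by exact_mod_cast h, rfl⟩

lemma norm_sq_res (v : ι → E) (A : Finset ι) (p : ι) :
    ‖v p‖ ^ 2 = ‖(W v A).starProjection (v p)‖ ^ 2 + ‖res v A p‖ ^ 2 := by
  have h : v p = (W v A).starProjection (v p) + res v A p := by unfold res; abel
  have h2 := res_orth v A p _ (Submodule.starProjection_apply_mem (W v A) (v p))
  calc ‖v p‖ ^ 2 = ‖(W v A).starProjection (v p) + res v A p‖ ^ 2 := by rw [← h]
    _ = _ := by rw [norm_add_sq_real, h2]; ring

lemma pot_start (v : ι → E) (hv : ∀ i, ‖v i‖ ≤ 1) (A : Finset ι) (p : ι) (z : ℝ)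
    (hz : |z| ≤ 1) (θ : E) :
    pot v A p z θ ≤ Real.exp (4 * ‖(W v (insert p A)).starProjection θ‖ ^ 2) := by
  have hm : res v A p ∈ W v (insert p A) :=
    Submodule.sub_mem _ (mem_W v (Finset.mem_insert_self p A))
      (W_mono v (Finset.subset_insert p A) (Submodule.starProjection_apply_mem _ _))
  have h1 := proj_ineq (W v (insert p A)) (W v A) (W_mono v (Finset.subset_insert p A))
    (res v A p) θ hm (res_orth v A p)
  unfold pot
  set s := ⟪θ, res v A p⟫_ℝ
  have hb : ‖res v A p‖ ≤ 1 := by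
    have := norm_sq_res v A p
    have h2 := hv p
    nlinarith [norm_nonneg (v p), norm_nonneg (res v A p), sq_nonneg ‖(W v A).starProjection (v p)‖]
  have hs : s ^ 2 ≤ s ^ 2 / ‖res v A p‖ ^ 2 := by
    by_cases h0 : res v A p = 0
    · have : s = 0 := by simp [s, h0]
      rw [this]; simp
    · have : 0 < ‖res v A p‖ := norm_pos_iff.2 h0
      rw [le_div_iff₀ (by positivity)]
      have : ‖res v A p‖ ^ 2 ≤ 1 := by nlinarith
      nlinarith [sq_nonneg s]
  have h3 := M_le s z hz
  have h4 : M s z * Real.exp (-(s * z)) ≤ Real.exp (s ^ 2) := by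
    calc _ ≤ Real.exp (s * z + s ^ 2) * Real.exp (-(s * z)) := by gcongr
      _ = _ := by rw [← Real.exp_add]; congr 1; ring
  refine (mul_le_mul_of_nonneg_left h4 (Real.exp_pos _).le).trans ?_
  rw [← Real.exp_add, Real.exp_le_exp]
  have : 0 ≤ s ^ 2 := sq_nonneg s
  linarith

lemma pot_shrink (v : ι → E) (hv : ∀ i, ‖v i‖ ≤ 1) (A B : Finset ι) (hBA : B ⊆ A) (p : ι) (z : ℝ)
    (hz : |z| ≤ 1) (θ : E) : pot v B p z θ ≤ pot v A p z θ := by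
  set d := res v B p - res v A p with hd
  have hd' : d = (W v A).starProjection (v p) - (W v B).starProjection (v p) := by
    rw [hd]; unfold res; abel
  have hdA : d ∈ W v A := by
    rw [hd']
    exact Submodule.sub_mem _ (Submodule.starProjection_apply_mem _ _)
      (W_mono v hBA (Submodule.starProjection_apply_mem _ _))
  have hdB : ∀ w ∈ W v B, ⟪w, d⟫_ℝ = 0 := by
    intro w hw
    rw [hd, inner_sub_right, res_orth v B p w hw, res_orth v A p w (W_mono v hBA hw), sub_zero]
  have h1 := proj_ineq (W v A) (W v B) (W_mono v hBA) d θ hdA hdB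
  have hsum : res v B p = res v A p + d := by rw [hd]; abel
  have hn : ‖res v B p‖ ^ 2 = ‖res v A p‖ ^ 2 + ‖d‖ ^ 2 := by
    rw [hsum, norm_add_sq_real, real_inner_comm, res_orth v A p d hdA]; ring
  have hin : ⟪θ, res v B p⟫_ℝ = ⟪θ, res v A p⟫_ℝ + ⟪θ, d⟫_ℝ := by rw [hsum, inner_add_right]
  have hb : ‖res v B p‖ ^ 2 ≤ 1 := by
    have := norm_sq_res v B p
    have h2 := hv p
    nlinarith [norm_nonneg (v p), sq_nonneg ‖(W v B).starProjection (v p)‖]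
  have hq := quad_ineq ⟪θ, res v A p⟫_ℝ ⟪θ, d⟫_ℝ (‖res v A p‖ ^ 2) (‖d‖ ^ 2)
    (by positivity) (by positivity) (by rw [← hn]; exact hb)
    (fun h => by
      have : res v A p = 0 := by simpa using h
      rw [this]; simp)
    (fun h => by
      have : d = 0 := by simpa using h
      rw [this]; simp)
  unfold pot
  rw [hn, hin]
  set s := ⟪θ, res v A p⟫_ℝ
  set e := ⟪θ, d⟫_ℝ
  have h3 := M_add s e z hz
  refine (mul_le_mul_of_nonneg_left h3 (Real.exp_pos _).le).trans ?_
  rw [mul_comm (M s z * Real.exp (-(s * z))), ← mul_assoc, ← Real.exp_add]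
  have := M_pos s z hz
  refine mul_le_mul_of_nonneg_right (Real.exp_le_exp.2 ?_) (by positivity)
  linarith

lemma pot_end (v : ι → E) (A : Finset ι) (p : ι) (z : ℝ)
    (hz : |z| ≤ 1) (θ : E) :
    Real.exp (4 * ‖(W v A).starProjection θ‖ ^ 2) ≤ pot v A p z θ := by
  unfold pot
  set s := ⟪θ, res v A p⟫_ℝ
  have h1 : 1 ≤ M s z * Real.exp (-(s * z)) := by
    have := M_ge s z hz
    calc (1 : ℝ) = Real.exp (s * z) * Real.exp (-(s * z)) := by rw [← Real.exp_add]; simp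
      _ ≤ _ := by gcongr
  calc Real.exp (4 * ‖(W v A).starProjection θ‖ ^ 2)
      ≤ Real.exp (4 * ‖(W v A).starProjection θ‖ ^ 2 + s ^ 2 / ‖res v A p‖ ^ 2) := by
        rw [Real.exp_le_exp]
        have : 0 ≤ s ^ 2 / ‖res v A p‖ ^ 2 := by positivity
        linarith
    _ ≤ _ := le_mul_of_one_le_right (Real.exp_pos _).le h1

lemma pm_of_abs {a : ℝ} (h : |a| = 1) : a = 1 ∨ a = -1 := eq_or_eq_neg_of_abs_eq h

/-- Boundary case of the pivot claim. -/
lemma PP_boundary (v : ι → E) (hv : ∀ i, ‖v i‖ ≤ 1) (θ : κ → E) (A : Finset ι) (p : ι)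
    (hp : p ∉ A) (hNP : NP v θ A) (hPP : ∀ i ∈ A, PP v θ (A.erase i) p)
    (x : ι → ℝ) (hx : ∀ i ∈ insert p A, |x i| ≤ 1) (w : κ → ℝ) (hw : ∀ j, 0 ≤ w j)
    (hb : ∃ i ∈ insert p A, |x i| = 1) : PPc v θ A p x w := by
  have hxp := hx p (Finset.mem_insert_self p A)
  obtain ⟨i, hi, hi1⟩ := hb
  rcases Finset.mem_insert.1 hi with rfl | hiA
  · obtain ⟨y, hy, hle⟩ := hNP x (fun k hk => hx k (Finset.mem_insert_of_mem hk)) w hw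
    refine ⟨Function.update y i (x i), ?_, ?_⟩
    · intro k hk
      by_cases hki : k = i
      · subst hki; simpa using pm_of_abs hi1
      · rw [Function.update_of_ne hki]
        exact hy k ((Finset.mem_insert.1 hk).resolve_left hki)
    · have e1 : ∑ k ∈ insert i A, (Function.update y i (x i) k - x k) • v k =
          ∑ k ∈ A, (y k - x k) • v k := by
        rw [Finset.sum_insert hp]
        simp only [Function.update_self, sub_self, zero_smul, zero_add]
        refine Finset.sum_congr rfl fun k hk => ?_
        have hki : k ≠ i := fun h => hp (h ▸ hk)
        rw [Function.update_of_ne hki]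
      rw [e1]
      refine hle.trans (Finset.sum_le_sum fun j _ => ?_)
      exact mul_le_mul_of_nonneg_left (pot_end v A i (x i) hxp (θ j)) (hw j)
  · have hpi : p ≠ i := fun h => hp (h ▸ hiA)
    have hsub : insert p (A.erase i) ⊆ insert p A :=
      Finset.insert_subset_insert _ (Finset.erase_subset _ _)
    obtain ⟨y, hy, hle⟩ := hPP i hiA x (fun k hk => hx k (hsub hk)) w hw
    have hins : insert p A = insert i (insert p (A.erase i)) := by
      rw [Finset.insert_comm, Finset.insert_erase hiA]
    have hnot : i ∉ insert p (A.erase i) := by simp [hpi.symm]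
    refine ⟨Function.update y i (x i), ?_, ?_⟩
    · intro k hk
      by_cases hki : k = i
      · subst hki; simpa using pm_of_abs hi1
      · rw [Function.update_of_ne hki]
        rw [hins] at hk
        exact hy k ((Finset.mem_insert.1 hk).resolve_left hki)
    · have e1 : ∑ k ∈ insert p A, (Function.update y i (x i) k - x k) • v k =
          ∑ k ∈ insert p (A.erase i), (y k - x k) • v k := by
        rw [hins, Finset.sum_insert hnot]
        simp only [Function.update_self, sub_self, zero_smul, zero_add]
        refine Finset.sum_congr rfl fun k hk => ?_
        have hki : k ≠ i := fun h => hnot (h ▸ hk)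
        rw [Function.update_of_ne hki]
      rw [e1]
      refine hle.trans (Finset.sum_le_sum fun j _ => ?_)
      exact mul_le_mul_of_nonneg_left
        (pot_shrink v hv A _ (Finset.erase_subset _ _) p (x p) hxp (θ j)) (hw j)

lemma PP_step (v : ι → E) (hv : ∀ i, ‖v i‖ ≤ 1) (θ : κ → E) (A : Finset ι) (p : ι)
    (hp : p ∉ A) (hNP : NP v θ A) (hPP : ∀ i ∈ A, PP v θ (A.erase i) p) : PP v θ A p := by
  intro x hx w hw
  -- the direction
  obtain ⟨a, ha⟩ : ∃ a : ι → ℝ, ∑ i ∈ A, a i • v i = (W v A).starProjection (v p) :=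
    Submodule.mem_span_image_finset_iff_exists_fun' ℝ |>.1
      (Submodule.starProjection_apply_mem (W v A) (v p))
  set b := res v A p with hb
  let u : ι → ℝ := fun i => if i = p then 1 else - a i
  have hup : u p = 1 := by simp [u]
  have hub : ∑ i ∈ insert p A, u i • v i = b := by
    rw [Finset.sum_insert hp, hup, one_smul, hb, res, ← ha, sub_eq_add_neg, ← Finset.sum_neg_distrib]
    congr 1
    refine Finset.sum_congr rfl fun k hk => ?_
    have : k ≠ p := fun h => hp (h ▸ hk)
    simp [u, this]
  -- the constants
  let D : κ → ℝ := fun j => w j *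
    Real.exp (4 * ‖(W v A).starProjection (θ j)‖ ^ 2 + ⟪θ j, b⟫_ℝ ^ 2 / ‖b‖ ^ 2) *
    Real.exp (-(⟪θ j, b⟫_ℝ * x p))
  have hpot : ∀ t : ℝ, ∑ j, (w j * Real.exp (t * ⟪θ j, b⟫_ℝ)) * pot v A p (x p + t) (θ j) =
      ∑ j, D j * M ⟪θ j, b⟫_ℝ (x p) + t * ∑ j, D j * Real.sinh ⟪θ j, b⟫_ℝ := by
    intro t
    rw [Finset.mul_sum, ← Finset.sum_add_distrib]
    refine Finset.sum_congr rfl fun j _ => ?_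
    have e1 : Real.exp (-(⟪θ j, b⟫_ℝ * (x p + t))) =
        Real.exp (-(⟪θ j, b⟫_ℝ * x p)) * Real.exp (-(t * ⟪θ j, b⟫_ℝ)) := by
      rw [← Real.exp_add]; congr 1; ring
    have e2 : Real.exp (t * ⟪θ j, b⟫_ℝ) * Real.exp (-(t * ⟪θ j, b⟫_ℝ)) = 1 := by
      rw [← Real.exp_add]; simp
    simp only [pot, D, ← hb]
    rw [e1]
    have e3 : M ⟪θ j, b⟫_ℝ (x p + t) = M ⟪θ j, b⟫_ℝ (x p) + t * Real.sinh ⟪θ j, b⟫_ℝ := by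
      unfold M; ring
    rw [e3]
    linear_combination (w j *
      Real.exp (4 * ‖(W v A).starProjection (θ j)‖ ^ 2 + ⟪θ j, b⟫_ℝ ^ 2 / ‖b‖ ^ 2) *
      Real.exp (-(⟪θ j, b⟫_ℝ * x p)) *
      (M ⟪θ j, b⟫_ℝ (x p) + t * Real.sinh ⟪θ j, b⟫_ℝ)) * e2
  -- choose the step
  obtain ⟨t, htx, hti, htα⟩ : ∃ t : ℝ, (∀ i ∈ insert p A, |x i + t * u i| ≤ 1) ∧
      (∃ i ∈ insert p A, |x i + t * u i| = 1) ∧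
      t * ∑ j, D j * Real.sinh ⟪θ j, b⟫_ℝ ≤ 0 := by
    rcases le_total (∑ j, D j * Real.sinh ⟪θ j, b⟫_ℝ) 0 with h | h
    · obtain ⟨t, h0, h1, h2⟩ := hit (insert p A) x u hx p (Finset.mem_insert_self p A)
        (by rw [hup]; norm_num)
      exact ⟨t, h1, h2, mul_nonpos_of_nonneg_of_nonpos h0 h⟩
    · obtain ⟨t, h0, h1, h2⟩ := hit (insert p A) x (fun i => - u i) hx p
        (Finset.mem_insert_self p A) (by rw [hup]; norm_num)
      refine ⟨-t, ?_, ?_, mul_nonpos_of_nonpos_of_nonneg (by linarith) h⟩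
      · intro i hi; simpa using h1 i hi
      · obtain ⟨i, hi, h3⟩ := h2
        exact ⟨i, hi, by simpa using h3⟩
  obtain ⟨y, hy, hle⟩ := PP_boundary v hv θ A p hp hNP hPP (fun i => x i + t * u i) htx
    (fun j => w j * Real.exp (t * ⟪θ j, b⟫_ℝ))
    (fun j => mul_nonneg (hw j) (Real.exp_pos _).le) hti
  refine ⟨y, hy, ?_⟩
  have e1 : ∑ i ∈ insert p A, (y i - x i) • v i =
      t • b + ∑ i ∈ insert p A, (y i - (x i + t * u i)) • v i := by
    rw [← hub, Finset.smul_sum, ← Finset.sum_add_distrib]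
    refine Finset.sum_congr rfl fun k _ => ?_
    rw [smul_smul, ← add_smul]; congr 1; ring
  have e2 : ∀ j, w j * Real.exp ⟪θ j, ∑ i ∈ insert p A, (y i - x i) • v i⟫_ℝ =
      (w j * Real.exp (t * ⟪θ j, b⟫_ℝ)) *
        Real.exp ⟪θ j, ∑ i ∈ insert p A, (y i - (x i + t * u i)) • v i⟫_ℝ := by
    intro j
    rw [e1, inner_add_right, inner_smul_right, Real.exp_add]; ring
  simp only [e2]
  refine hle.trans ?_
  simp only [hup, mul_one]
  rw [hpot t]
  have h0 := hpot 0
  simp only [zero_mul, Real.exp_zero, mul_one, add_zero] at h0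
  rw [h0]
  linarith

lemma NP_PP (v : ι → E) (hv : ∀ i, ‖v i‖ ≤ 1) (θ : κ → E) (n : ℕ) :
    ∀ A : Finset ι, A.card = n → NP v θ A ∧ ∀ p, p ∉ A → PP v θ A p := by
  induction n with
  | zero =>
    intro A hA
    rw [Finset.card_eq_zero] at hA
    subst hA
    have hNP : NP v θ (∅ : Finset ι) := by
      intro x _ w hw
      refine ⟨fun _ => 1, by simp, Finset.sum_le_sum fun j _ => ?_⟩
      refine mul_le_mul_of_nonneg_left ?_ (hw j)
      rw [Real.exp_le_exp]
      simp only [Finset.sum_empty, inner_zero_right]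
      positivity
    exact ⟨hNP, fun p hp => PP_step v hv θ _ p hp hNP (by simp)⟩
  | succ n ih =>
    intro A hA
    have hNP : NP v θ A := by
      intro x hx w hw
      obtain ⟨p, hp⟩ : A.Nonempty := Finset.card_pos.1 (by omega)
      have hc : (A.erase p).card = n := by rw [Finset.card_erase_of_mem hp, hA]; rfl
      have hins := Finset.insert_erase hp
      obtain ⟨y, hy, hle⟩ := (ih _ hc).2 p (Finset.notMem_erase p A) x
        (by rw [hins]; exact hx) w hw
      rw [hins] at hy hle
      refine ⟨y, hy, hle.trans (Finset.sum_le_sum fun j _ => ?_)⟩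
      refine mul_le_mul_of_nonneg_left ?_ (hw j)
      have := pot_start v hv (A.erase p) p (x p) (hx p hp) (θ j)
      rwa [hins] at this
    refine ⟨hNP, fun p hp => PP_step v hv θ _ p hp hNP fun i hi => ?_⟩
    have hc : (A.erase i).card = n := by rw [Finset.card_erase_of_mem hi, hA]; rfl
    exact (ih _ hc).2 p (fun h => hp (Finset.mem_of_mem_erase h))

/-- Subgaussian coloring, in derandomized form. -/
lemma coloring [Fintype ι] (v : ι → E) (hv : ∀ i, ‖v i‖ ≤ 1) (θ : κ → E) :
    ∃ y : ι → ℝ, (∀ i, y i = 1 ∨ y i = -1) ∧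
      ∑ j, Real.exp ⟪θ j, ∑ i, y i • v i⟫_ℝ ≤ ∑ j, Real.exp (4 * ‖θ j‖ ^ 2) := by
  obtain ⟨y, hy, hle⟩ := (NP_PP v hv θ _ Finset.univ rfl).1 (fun _ => 0) (by simp)
    (fun _ => 1) (by simp)
  refine ⟨y, fun i => hy i (Finset.mem_univ i), ?_⟩
  simp only [one_mul, sub_zero] at hle
  refine hle.trans (Finset.sum_le_sum fun j _ => ?_)
  rw [Real.exp_le_exp]
  have := (W v Finset.univ).norm_starProjection_apply_le (θ j)
  gcongr

end walk

end Komlos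

/-- **Deterministic Bansal–Dadush–Garg (Theorem 4).** There is a universal constant `C > 0`
such that for every matrix `A ∈ ℝ^{m×n}` (`m ≥ 1`, `n ≥ 2`) whose columns have Euclidean
length at most `1`, there is a coloring `x ∈ {-1,1}^n` with `‖Ax‖_∞ ≤ C √(log n)`. -/
theorem stmt_5 :
    ∃ C : ℝ, 0 < C ∧
      ∀ (m n : ℕ), 1 ≤ m → 2 ≤ n →
        ∀ A : Matrix (Fin m) (Fin n) ℝ,
          (∀ j, ∑ i, (A i j) ^ 2 ≤ 1) →
          ∃ x : Fin n → ℝ,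
            (∀ j, x j = 1 ∨ x j = -1) ∧
            ∀ i, |∑ j, A i j * x j| ≤ C * Real.sqrt (Real.log n) := by
  refine ⟨7, by norm_num, fun m n _ hn A hA => ?_⟩
  set lam := Real.sqrt (Real.log n) with hlam
  have hn' : (2 : ℝ) ≤ n := by exact_mod_cast hn
  have hlog2 : (0.69 : ℝ) < Real.log 2 := by have := Real.log_two_gt_d9; linarith
  have hlogn : Real.log 2 ≤ Real.log n := Real.log_le_log (by norm_num) hn'
  have hlam2 : lam ^ 2 = Real.log n := Real.sq_sqrt (by linarith)
  have hlam0 : 0 ≤ lam := Real.sqrt_nonneg _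
  have hlamp : 1 / 2 < lam := by nlinarith
  classical
  -- big rows
  let R : Finset (Fin m) := Finset.univ.filter fun i => 1 < n * ∑ j, (A i j) ^ 2
  have hR : (R.card : ℝ) ≤ n ^ 2 := by
    have h1 : ∑ i, ∑ j, (A i j) ^ 2 ≤ n := by
      rw [Finset.sum_comm]
      calc ∑ j, ∑ i, (A i j) ^ 2 ≤ ∑ _j : Fin n, (1 : ℝ) := Finset.sum_le_sum fun j _ => hA j
        _ = n := by simp
    calc (R.card : ℝ) = ∑ i ∈ R, (1 : ℝ) := by simp
      _ ≤ ∑ i ∈ R, n * ∑ j, (A i j) ^ 2 :=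
          Finset.sum_le_sum fun i hi => (Finset.mem_filter.1 hi).2.le
      _ ≤ ∑ i, n * ∑ j, (A i j) ^ 2 :=
          Finset.sum_le_sum_of_subset_of_nonneg (Finset.subset_univ _)
            fun i _ _ => mul_nonneg (by linarith) (Finset.sum_nonneg fun j _ => sq_nonneg _)
      _ = n * ∑ i, ∑ j, (A i j) ^ 2 := by rw [Finset.mul_sum]
      _ ≤ n * n := mul_le_mul_of_nonneg_left h1 (by linarith)
      _ = _ := by ring
  let v : Fin n → EuclideanSpace ℝ (Fin m) := fun j => WithLp.toLp 2 fun i => A i j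
  have hv : ∀ j, ‖v j‖ ≤ 1 := by
    intro j
    rw [EuclideanSpace.norm_eq]
    apply Real.sqrt_le_one.2
    simpa [v] using hA j
  let θ : R × Bool → EuclideanSpace ℝ (Fin m) := fun k =>
    EuclideanSpace.single k.1.1 (if k.2 then lam else -lam)
  obtain ⟨x, hx, hle⟩ := Komlos.coloring v hv θ
  refine ⟨x, hx, fun i => ?_⟩
  by_cases hi : i ∈ R
  · have hcoord : ∀ b : Bool, ⟪θ (⟨i, hi⟩, b), ∑ j, x j • v j⟫_ℝ =
        (if b then lam else -lam) * ∑ j, A i j * x j := by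
      intro b
      simp only [θ, EuclideanSpace.inner_single_left, v]
      simp [mul_comm]
    have hnorm : ∀ k, ‖θ k‖ ^ 2 = Real.log n := by
      intro k
      simp only [θ, EuclideanSpace.norm_single, Real.norm_eq_abs, sq_abs]
      split_ifs <;> simp [hlam2]
    simp only [hnorm] at hle
    have hn0 : (0 : ℝ) < n := by linarith
    have hn7 : Real.exp (7 * Real.log n) = (n : ℝ) ^ 7 := by
      rw [show (7 : ℝ) = ((7 : ℕ) : ℝ) by norm_num, Real.exp_nat_mul, Real.exp_log hn0]
    have hn4 : Real.exp (4 * Real.log n) = (n : ℝ) ^ 4 := by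
      rw [show (4 : ℝ) = ((4 : ℕ) : ℝ) by norm_num, Real.exp_nat_mul, Real.exp_log hn0]
    have hub : ∑ _k : R × Bool, Real.exp (4 * Real.log n) ≤ Real.exp (7 * Real.log n) := by
      rw [hn7, hn4]
      simp only [Finset.sum_const, Finset.card_univ, Fintype.card_prod, Fintype.card_coe,
        Fintype.card_bool, nsmul_eq_mul, Nat.cast_mul]
      calc (R.card : ℝ) * ((2 : ℕ) : ℝ) * (n : ℝ) ^ 4 ≤ (n : ℝ) ^ 2 * n * (n : ℝ) ^ 4 := by
            gcongr
        _ = _ := by ring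
    have hb : ∀ b : Bool, (if b then lam else -lam) * ∑ j, A i j * x j ≤ 7 * Real.log n := by
      intro b
      rw [← Real.exp_le_exp, ← hcoord b]
      refine le_trans ?_ (hle.trans hub)
      exact Finset.single_le_sum
        (f := fun k => Real.exp ⟪θ k, ∑ j, x j • v j⟫_ℝ)
        (fun k _ => (Real.exp_pos _).le) (Finset.mem_univ ((⟨i, hi⟩, b) : R × Bool))
    have h1 := hb true
    have h2 := hb false
    simp only [if_true, Bool.false_eq_true, if_false] at h1 h2
    rw [← hlam2] at h1 h2
    have hp : 0 < lam := by linarith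
    rw [abs_le]
    constructor
    · apply le_of_mul_le_mul_left _ hp
      nlinarith
    · apply le_of_mul_le_mul_left _ hp
      nlinarith
  · have h1 : n * ∑ j, (A i j) ^ 2 ≤ 1 := by
      by_contra h
      exact hi (Finset.mem_filter.2 ⟨Finset.mem_univ _, not_le.1 h⟩)
    have hx2 : ∑ j, (x j) ^ 2 = n := by
      have : ∀ j, (x j) ^ 2 = 1 := fun j => by rcases hx j with h | h <;> rw [h] <;> norm_num
      simp [this]
    have h2 := Finset.sum_mul_sq_le_sq_mul_sq Finset.univ (fun j => A i j) x
    rw [hx2] at h2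
    have h3 : |∑ j, A i j * x j| ≤ 1 := by
      rw [← sq_le_one_iff_abs_le_one]; linarith
    linarith
end

section
/- There exists a universal constant C > 0 such that the following holds. Let S_1, …, S_m ⊆ {1,…,n} be a set system (with n ≥ 2) in which every element j ∈ {1,…,n} is contained in at most t of the sets. Then there exists a coloring x ∈ {-1,1}^n with |∑_{j ∈ S_i} x_j| ≤ C·√(t·log n) for every i ∈ {1,…,m}. -/
/-- The normalised two-point moment generating function. -/
noncomputable def bfC (y a : ℝ) : ℝ := Real.cosh a + y * Real.sinh a

/-- The sub-Gaussian deficit of a two-point distribution. -/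
noncomputable def bfH (y a : ℝ) : ℝ := a ^ 2 / 2 - Real.log (bfC y a) + y * a

lemma bfC_pos {y : ℝ} (h1 : -1 ≤ y) (h2 : y ≤ 1) (a : ℝ) : 0 < bfC y a := by
  unfold bfC
  rw [Real.cosh_eq, Real.sinh_eq]
  have e1 := Real.exp_pos a
  have e2 := Real.exp_pos (-a)
  rcases le_total 0 y with h | h <;> nlinarith

lemma bfC_hasDerivAt (y a : ℝ) :
    HasDerivAt (bfC y) (Real.sinh a + y * Real.cosh a) a := by
  unfold bfC
  exact (Real.hasDerivAt_cosh a).add ((Real.hasDerivAt_sinh a).const_mul y)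

lemma bfQ_hasDerivAt {y : ℝ} (h1 : -1 ≤ y) (h2 : y ≤ 1) (a : ℝ) :
    HasDerivAt (fun a => a + y - (Real.sinh a + y * Real.cosh a) / bfC y a)
      (((Real.sinh a + y * Real.cosh a) / bfC y a) ^ 2) a := by
  have hc := (bfC_pos h1 h2 a).ne'
  have hn : HasDerivAt (fun a => Real.sinh a + y * Real.cosh a) (bfC y a) a := by
    unfold bfC
    exact (Real.hasDerivAt_sinh a).add ((Real.hasDerivAt_cosh a).const_mul y)
  refine HasDerivAt.congr_deriv
    (((hasDerivAt_id a).add_const y).sub (hn.div (bfC_hasDerivAt y a) hc)) ?_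
  field_simp
  ring

lemma bfQ_nonneg {y : ℝ} (h1 : -1 ≤ y) (h2 : y ≤ 1) {a : ℝ} (ha : 0 ≤ a) :
    0 ≤ a + y - (Real.sinh a + y * Real.cosh a) / bfC y a := by
  have hm : Monotone (fun a => a + y - (Real.sinh a + y * Real.cosh a) / bfC y a) := by
    apply monotone_of_deriv_nonneg
    · exact fun a => (bfQ_hasDerivAt h1 h2 a).differentiableAt
    · intro a
      rw [(bfQ_hasDerivAt h1 h2 a).deriv]
      positivity
  have := hm ha
  simpa [bfC] using this

lemma bfG_hasDerivAt {y : ℝ} (h1 : -1 ≤ y) (h2 : y ≤ 1) (a : ℝ) :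
    HasDerivAt (fun a => Real.log (bfC y a) - y * a)
      ((Real.sinh a + y * Real.cosh a) / bfC y a - y) a := by
  have hc := (bfC_pos h1 h2 a).ne'
  refine HasDerivAt.congr_deriv
    (((bfC_hasDerivAt y a).log hc).sub ((hasDerivAt_id a).const_mul y)) ?_
  simp

lemma bfH_hasDerivAt {y : ℝ} (h1 : -1 ≤ y) (h2 : y ≤ 1) (a : ℝ) :
    HasDerivAt (bfH y) (a + y - (Real.sinh a + y * Real.cosh a) / bfC y a) a := by
  have h := (((hasDerivAt_id a).pow 2).div_const 2).sub (bfG_hasDerivAt h1 h2 a)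
  have e : bfH y = fun a => a ^ 2 / 2 - (Real.log (bfC y a) - y * a) := by
    ext b
    unfold bfH
    ring
  rw [e]
  refine HasDerivAt.congr_deriv h ?_
  simp
  ring

lemma bfH_mono {y : ℝ} (h1 : -1 ≤ y) (h2 : y ≤ 1) : MonotoneOn (bfH y) (Set.Ici 0) := by
  apply monotoneOn_of_deriv_nonneg (convex_Ici 0)
  · exact fun a _ => (bfH_hasDerivAt h1 h2 a).continuousAt.continuousWithinAt
  · exact fun a _ => (bfH_hasDerivAt h1 h2 a).differentiableAt.differentiableWithinAt
  · intro a ha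
    rw [interior_Ici] at ha
    rw [(bfH_hasDerivAt h1 h2 a).deriv]
    exact bfQ_nonneg h1 h2 (le_of_lt ha)

lemma bfG_mono {y : ℝ} (h1 : -1 ≤ y) (h2 : y ≤ 1) :
    MonotoneOn (fun a => Real.log (bfC y a) - y * a) (Set.Ici 0) := by
  apply monotoneOn_of_deriv_nonneg (convex_Ici 0)
  · exact fun a _ => (bfG_hasDerivAt h1 h2 a).continuousAt.continuousWithinAt
  · exact fun a _ => (bfG_hasDerivAt h1 h2 a).differentiableAt.differentiableWithinAt
  · intro a ha
    rw [interior_Ici] at ha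
    rw [(bfG_hasDerivAt h1 h2 a).deriv]
    have hc := bfC_pos h1 h2 a
    have hs : 0 ≤ Real.sinh a := Real.sinh_nonneg_iff.2 (le_of_lt ha)
    have : (Real.sinh a + y * Real.cosh a) / bfC y a - y
        = (1 - y ^ 2) * Real.sinh a / bfC y a := by
      field_simp
      unfold bfC
      ring
    rw [this]
    have : 0 ≤ 1 - y ^ 2 := by nlinarith
    positivity

lemma bfH_zero (y : ℝ) : bfH y 0 = 0 := by simp [bfH, bfC]

lemma bfH_neg (y a : ℝ) : bfH y (-a) = bfH (-y) a := by simp [bfH, bfC]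

lemma bfH_nonneg {y : ℝ} (h1 : -1 ≤ y) (h2 : y ≤ 1) (a : ℝ) : 0 ≤ bfH y a := by
  rcases le_total 0 a with h | h
  · have := bfH_mono h1 h2 (Set.mem_Ici.2 le_rfl) (Set.mem_Ici.2 h) h
    rwa [bfH_zero] at this
  · have := bfH_mono (y := -y) (by linarith) (by linarith) (Set.mem_Ici.2 le_rfl)
      (a := 0) (b := -a) (Set.mem_Ici.2 (by linarith)) (by linarith)
    rwa [bfH_zero, bfH_neg, neg_neg] at this

lemma bfH_sub_le_aux {y : ℝ} (h1 : -1 ≤ y) (h2 : y ≤ 1) {a b : ℝ} (ha : 0 ≤ a) :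
    bfH y a - bfH y b ≤ 2 * max 0 (a * (a - b)) := by
  have hb := bfH_nonneg h1 h2 b
  rcases le_total a b with h | h
  · have := bfH_mono h1 h2 (Set.mem_Ici.2 ha) (Set.mem_Ici.2 (ha.trans h)) h
    have := le_max_left 0 (a * (a - b))
    linarith
  · have hm := le_max_right 0 (a * (a - b))
    rcases le_total 0 b with h0 | h0
    · have := bfG_mono h1 h2 (Set.mem_Ici.2 h0) (Set.mem_Ici.2 ha) h
      simp only at this
      have e : bfH y a - bfH y b ≤ a ^ 2 / 2 - b ^ 2 / 2 := by unfold bfH; linarith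
      nlinarith
    · have := bfG_mono h1 h2 (Set.mem_Ici.2 le_rfl) (Set.mem_Ici.2 ha) ha
      simp only [bfC, Real.cosh_zero, Real.sinh_zero, mul_zero, add_zero, Real.log_one,
        sub_zero] at this
      have e : bfH y a ≤ a ^ 2 / 2 := by unfold bfH bfC; linarith
      nlinarith

lemma bfH_sub_le {y : ℝ} (h1 : -1 ≤ y) (h2 : y ≤ 1) (a b : ℝ) :
    bfH y a - bfH y b ≤ 2 * max 0 (a * (a - b)) := by
  rcases le_total 0 a with h | h
  · exact bfH_sub_le_aux h1 h2 h
  · have := bfH_sub_le_aux (y := -y) (by linarith) (by linarith) (a := -a) (b := -b)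
      (by linarith)
    rw [bfH_neg, bfH_neg, neg_neg] at this
    convert this using 3
    ring

lemma bfH_exp {y : ℝ} (h1 : -1 ≤ y) (h2 : y ≤ 1) (a : ℝ) :
    Real.exp (- bfH y a) = bfC y a * Real.exp (- a ^ 2 / 2 - y * a) := by
  have : - bfH y a = Real.log (bfC y a) + (- a ^ 2 / 2 - y * a) := by unfold bfH; ring
  rw [this, Real.exp_add, Real.exp_log (bfC_pos h1 h2 a)]

section geometry
variable {E : Type*} [NormedAddCommGroup E] [InnerProductSpace ℝ E] [FiniteDimensional ℝ E]

/-- Squared norm of the orthogonal projection. -/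
noncomputable def bfN (U : Submodule ℝ E) (θ : E) : ℝ := ‖U.starProjection θ‖ ^ 2

/-- Component of `v` orthogonal to `W`. -/
noncomputable def bfW (W : Submodule ℝ E) (v : E) : E := v - W.starProjection v

lemma bfN_gap {U U' : Submodule ℝ E} (h : U' ≤ U) (θ z : E) (hz : z ∈ U)
    (hz' : ∀ u ∈ U', inner ℝ u z = 0) :
    (inner ℝ θ z) ^ 2 ≤ ‖z‖ ^ 2 * (bfN U θ - bfN U' θ) := by
  set d := U.starProjection θ - U'.starProjection θ with hd
  have e1 : inner ℝ θ z = inner ℝ d z := by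
    have h1 := U.starProjection_inner_eq_zero θ z hz
    have h2 := hz' _ (U'.starProjection_apply_mem θ)
    rw [inner_sub_left] at h1
    rw [hd, inner_sub_left, h2]
    linarith
  have e2 : inner ℝ d (U'.starProjection θ) = 0 := by
    have h1 := U.starProjection_inner_eq_zero θ _ (h (U'.starProjection_apply_mem θ))
    have h2 := U'.starProjection_inner_eq_zero θ _ (U'.starProjection_apply_mem θ)
    rw [inner_sub_left] at h1 h2
    rw [hd, inner_sub_left]
    linarith
  have e3 : bfN U θ - bfN U' θ = ‖d‖ ^ 2 := by
    have : U.starProjection θ = d + U'.starProjection θ := by rw [hd]; abel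
    unfold bfN
    rw [this, norm_add_sq_real, e2]
    ring
  rw [e1, e3, ← mul_pow]
  apply sq_le_sq'
  · have := neg_le_of_abs_le (abs_real_inner_le_norm d z)
    linarith
  · have := real_inner_le_norm d z
    linarith

lemma bfN_nonneg (U : Submodule ℝ E) (θ : E) : 0 ≤ bfN U θ := by unfold bfN; positivity

lemma bfN_le (U : Submodule ℝ E) (θ : E) : bfN U θ ≤ ‖θ‖ ^ 2 := by
  unfold bfN
  gcongr
  exact U.norm_starProjection_apply_le θ

lemma bfN_mono {U U' : Submodule ℝ E} (h : U' ≤ U) (θ : E) : bfN U' θ ≤ bfN U θ := by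
  have : U'.starProjection θ = U'.starProjection (U.starProjection θ) := by
    have := congrArg (fun f => f θ) (Submodule.starProjection_comp_starProjection_of_le h)
    simpa using this.symm
  unfold bfN
  rw [this]
  gcongr
  exact U'.norm_starProjection_apply_le _

lemma bfW_orth (W : Submodule ℝ E) (v : E) (u : E) (hu : u ∈ W) : inner ℝ u (bfW W v) = 0 := by
  rw [real_inner_comm]
  exact W.starProjection_inner_eq_zero v u hu

lemma bfW_norm (W : Submodule ℝ E) (v : E) : ‖bfW W v‖ ≤ ‖v‖ := by
  have h := bfW_orth W v _ (W.starProjection_apply_mem v)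
  have : v = W.starProjection v + bfW W v := by unfold bfW; abel
  have e : ‖v‖ ^ 2 = ‖W.starProjection v‖ ^ 2 + ‖bfW W v‖ ^ 2 := by
    conv_lhs => rw [this]
    rw [norm_add_sq_real, h]; ring
  apply le_of_sq_le_sq _ (norm_nonneg _)
  nlinarith [sq_nonneg ‖W.starProjection v‖]

/-- End of a pivot phase. -/
lemma bf_end (W : Submodule ℝ E) (U : Submodule ℝ E) (hW : W ≤ U) (v θ : E) (hv : ‖v‖ ≤ 1)
    (hvU : v ∈ U) :
    bfN W θ ≤ bfN U θ - (inner ℝ θ (bfW W v)) ^ 2 := by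
  have h := bfN_gap hW θ (bfW W v) (U.sub_mem hvU (hW (W.starProjection_apply_mem v)))
    (bfW_orth W v)
  have h1 := (bfW_norm W v).trans hv
  have h2 := bfN_mono hW θ
  have h3 : ‖bfW W v‖ ^ 2 ≤ 1 := by nlinarith [norm_nonneg (bfW W v)]
  nlinarith

/-- Freezing of non-pivot elements. -/
lemma bf_freeze (W W' U U' : Submodule ℝ E) (v θ : E) (hv : ‖v‖ ≤ 1) (hW : W' ≤ W)
    (hU : U = W ⊔ Submodule.span ℝ {v}) (hU' : U' = W' ⊔ Submodule.span ℝ {v})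
    {y : ℝ} (h1 : -1 ≤ y) (h2 : y ≤ 1) :
    bfN U' θ / 2 - bfH y (inner ℝ θ (bfW W' v)) ≤ bfN U θ / 2 - bfH y (inner ℝ θ (bfW W v)) := by
  set w := bfW W v with hw
  set w' := bfW W' v with hw'
  have hWU : W ≤ U := hU ▸ le_sup_left
  have hvU : v ∈ U := by
    rw [hU]; exact Submodule.mem_sup_right (Submodule.mem_span_singleton_self v)
  have hUU : U' ≤ U := by rw [hU, hU']; exact sup_le_sup_right hW _
  set r := w' - w with hr
  have hrW : r ∈ W := by
    have : r = W.starProjection v - W'.starProjection v := by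
      rw [hr, hw, hw']; unfold bfW; abel
    rw [this]
    exact W.sub_mem (W.starProjection_apply_mem v) (hW (W'.starProjection_apply_mem v))
  have hwU : w ∈ U := U.sub_mem hvU (hWU (W.starProjection_apply_mem v))
  have hrw : inner ℝ r w = 0 := bfW_orth W v r hrW
  have hwr : inner ℝ w r = 0 := by rw [real_inner_comm]; exact hrw
  have hww : w' = w + r := by rw [hr]; abel
  set R := ‖r‖ ^ 2 with hR
  set S := ‖w‖ ^ 2 with hS
  have hR0 : 0 ≤ R := by positivity
  have hS0 : 0 ≤ S := by positivity
  have hRS : R + S ≤ 1 := by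
    have e : ‖w'‖ ^ 2 = S + R := by rw [hww, norm_add_sq_real, hwr]; ring
    have := (bfW_norm W' v).trans hv
    nlinarith [norm_nonneg w']
  set z := R • w - S • r with hz
  have hzU : z ∈ U := U.sub_mem (U.smul_mem _ hwU) (U.smul_mem _ (hWU hrW))
  have hzw : ∀ u ∈ W', inner ℝ u z = 0 := by
    intro u hu
    have a1 : inner ℝ u w = 0 := bfW_orth W v u (hW hu)
    have a2 : inner ℝ u w' = 0 := bfW_orth W' v u hu
    rw [hz, hr]
    simp [inner_sub_right, inner_smul_right, a1, a2]
  have hzw' : inner ℝ w' z = 0 := by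
    rw [hz, hww]
    simp only [inner_sub_right, inner_add_left, inner_smul_right, hwr, hrw,
      real_inner_self_eq_norm_sq]
    rw [← hR, ← hS]; ring
  have hzv : inner ℝ v z = 0 := by
    have : v = W'.starProjection v + w' := by rw [hw']; unfold bfW; abel
    rw [this, inner_add_left, hzw', hzw _ (W'.starProjection_apply_mem v), add_zero]
  have hz' : ∀ u ∈ U', inner ℝ u z = 0 := by
    intro u hu
    rw [hU', Submodule.mem_sup] at hu
    obtain ⟨p, hp, q, hq, rfl⟩ := hu
    obtain ⟨c, rfl⟩ := Submodule.mem_span_singleton.1 hq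
    rw [inner_add_left, hzw p hp, inner_smul_left, hzv]
    simp
  have hgap := bfN_gap hUU θ z hzU hz'
  have hmono := bfN_mono hUU θ
  set D := bfN U θ - bfN U' θ with hD
  have hD0 : 0 ≤ D := by linarith
  have hzn : ‖z‖ ^ 2 = R * S * (R + S) := by
    rw [hz, norm_sub_sq_real, norm_smul, norm_smul, inner_smul_left, inner_smul_right, hwr,
      mul_pow, mul_pow, ← hR, ← hS]
    simp
    ring
  have hzi : inner ℝ θ z = R * inner ℝ θ w - S * inner ℝ θ r := by
    rw [hz, inner_sub_right, inner_smul_right, inner_smul_right]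
  have hw'i : inner ℝ θ w' = inner ℝ θ w + inner ℝ θ r := by rw [hww, inner_add_right]
  rw [hzn, hzi] at hgap
  have hH := bfH_sub_le h1 h2 (inner ℝ θ w) (inner ℝ θ w')
  have key : 2 * max 0 (inner ℝ θ w * (inner ℝ θ w - inner ℝ θ w')) ≤ D / 2 := by
    rw [hw'i]
    set a : ℝ := inner ℝ θ w with ha
    set b : ℝ := inner ℝ θ r with hb
    have : 4 * max 0 (a * (a - (a + b))) ≤ D := by
      rcases eq_or_lt_of_le (mul_nonneg hR0 hS0) with h0 | h0
      · rcases mul_eq_zero.1 h0.symm with h | h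
        · have : r = 0 := by simpa [hR] using h
          have : b = 0 := by rw [hb, this]; simp
          simp [this, hD0]
        · have : w = 0 := by simpa [hS] using h
          have : a = 0 := by rw [ha, this]; simp
          simp [this, hD0]
      · rw [mul_max_of_nonneg _ _ (by norm_num), max_le_iff]
        refine ⟨by simpa using hD0, ?_⟩
        have q : (R * S) * (4 * (a * (a - (a + b)))) ≤ (R * S) * D := by
          nlinarith [sq_nonneg (R * a + S * b), mul_nonneg (mul_nonneg h0.le hD0) (sub_nonneg.2 hRS)]
        exact le_of_mul_le_mul_left q h0
    linarith
  linarith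

end geometry

section walk
variable {E : Type*} [NormedAddCommGroup E] [InnerProductSpace ℝ E] [FiniteDimensional ℝ E]

lemma bfH_one (a : ℝ) : bfH 1 a = a ^ 2 / 2 := by
  unfold bfH bfC
  rw [one_mul, Real.cosh_add_sinh, Real.log_exp]; ring

lemma bfH_neg_one (a : ℝ) : bfH (-1) a = a ^ 2 / 2 := by
  have := bfH_neg 1 a
  rw [← this, bfH_one]; ring

/-- Coordinates that are not yet integral. -/
noncomputable def bfAlive {n : ℕ} (x : Fin n → ℝ) : Finset (Fin n) := by
  classical exact Finset.univ.filter fun j => x j ≠ 1 ∧ x j ≠ -1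

lemma mem_bfAlive {n : ℕ} (x : Fin n → ℝ) (j : Fin n) :
    j ∈ bfAlive x ↔ x j ≠ 1 ∧ x j ≠ -1 := by
  simp [bfAlive]

/-- Signed vector sum. -/
noncomputable def bfV {n : ℕ} (v : Fin n → E) (x : Fin n → ℝ) : E := ∑ j, x j • v j

/-- Span of a subfamily. -/
def bfS {n : ℕ} (v : Fin n → E) (A : Finset (Fin n)) : Submodule ℝ E :=
  Submodule.span ℝ (v '' (A : Set (Fin n)))

lemma bfS_mono {n : ℕ} (v : Fin n → E) {A B : Finset (Fin n)} (h : A ⊆ B) :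
    bfS v A ≤ bfS v B := Submodule.span_mono (Set.image_mono (by exact_mod_cast h))

lemma bfS_erase {n : ℕ} (v : Fin n → E) {A : Finset (Fin n)} {p : Fin n} (h : p ∈ A) :
    bfS v A = bfS v (A.erase p) ⊔ Submodule.span ℝ {v p} := by
  unfold bfS
  rw [← Submodule.span_union]
  congr 1
  conv_lhs => rw [← Finset.insert_erase h]
  rw [Finset.coe_insert, Set.image_insert_eq, Set.union_comm, Set.singleton_union]

/-- Walk along a ray until a coordinate freezes. -/
lemma bf_ray {n : ℕ} (x u : Fin n → ℝ) (hx : ∀ j, -1 ≤ x j ∧ x j ≤ 1)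
    (hu : ∀ j, j ∉ bfAlive x → u j = 0) (p : Fin n) (hp : u p ≠ 0) :
    ∃ δ : ℝ, 0 ≤ δ ∧ (∀ j, -1 ≤ x j + δ * u j ∧ x j + δ * u j ≤ 1) ∧
      bfAlive (fun j => x j + δ * u j) ⊂ bfAlive x := by
  classical
  let τ : Fin n → ℝ := fun j => if 0 < u j then (1 - x j) / u j else (1 + x j) / (- u j)
  obtain ⟨q, hq, hmin⟩ := Finset.exists_min_image (Finset.univ.filter fun j => u j ≠ 0) τ
    ⟨p, by simpa using hp⟩
  simp only [Finset.mem_filter, Finset.mem_univ, true_and] at hq hmin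
  have hτ : 0 ≤ τ q := by
    have := hx q
    simp only [τ]
    split_ifs with h
    · exact div_nonneg (by linarith) h.le
    · exact div_nonneg (by linarith) (by linarith)
  refine ⟨τ q, hτ, ?_, ?_⟩
  · intro j
    have hj := hx j
    rcases lt_trichotomy (u j) 0 with h | h | h
    · have h1 := hmin j h.ne
      have h2 : τ j = (1 + x j) / (- u j) := by simp [τ, not_lt.2 h.le]
      rw [h2, le_div_iff₀ (by linarith)] at h1
      constructor <;> nlinarith
    · rw [h]; simpa using hj
    · have h1 := hmin j h.ne'
      have h2 : τ j = (1 - x j) / (u j) := by simp [τ, h]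
      rw [h2, le_div_iff₀ (by linarith)] at h1
      constructor <;> nlinarith
  · rw [Finset.ssubset_iff_of_subset]
    · refine ⟨q, ?_, ?_⟩
      · by_contra h
        exact hq (hu q h)
      · rw [mem_bfAlive]
        intro hh
        rcases lt_or_gt_of_ne hq with h | h
        · apply hh.2
          have h2 : τ q = (1 + x q) / (- u q) := by simp [τ, not_lt.2 h.le]
          rw [h2]; field_simp; ring
        · apply hh.1
          have h2 : τ q = (1 - x q) / (u q) := by simp [τ, h]
          rw [h2]; field_simp; ring
    · intro j hj
      by_contra h
      rw [mem_bfAlive, hu j h] at hj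
      apply h
      rw [mem_bfAlive]
      simpa using hj

lemma bf_dir {n : ℕ} (v : Fin n → E) (A : Finset (Fin n)) (p : Fin n) (hp : p ∈ A) :
    ∃ u : Fin n → ℝ, u p = 1 ∧ (∀ j, j ∉ A → u j = 0) ∧
      bfV v u = bfW (bfS v (A.erase p)) (v p) := by
  classical
  have h : (bfS v (A.erase p)).starProjection (v p) ∈
      Submodule.span ℝ (v '' ((A.erase p : Finset (Fin n)) : Set (Fin n))) :=
    (bfS v (A.erase p)).starProjection_apply_mem (v p)
  rw [Submodule.mem_span_image_finset_iff_exists_fun] at h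
  obtain ⟨c, hc⟩ := h
  refine ⟨fun j => (if j = p then 1 else 0) - (if h : j ∈ A.erase p then c ⟨j, h⟩ else 0), ?_, ?_, ?_⟩
  · simp
  · intro j hj
    have h1 : j ≠ p := fun h => hj (h ▸ hp)
    simp [h1, hj]
  · unfold bfV bfW
    rw [← hc]
    simp only [sub_smul, Finset.sum_sub_distrib, ite_smul, one_smul, zero_smul,
      Finset.sum_ite_eq', Finset.mem_univ, if_true]
    congr 1
    rw [← Finset.sum_subset (Finset.subset_univ (A.erase p))]
    · rw [← Finset.sum_coe_sort (A.erase p)]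
      refine Finset.sum_congr rfl fun j _ => ?_
      rw [dif_pos j.2]
    · intro j _ hj
      rw [dif_neg hj, zero_smul]

lemma bfV_add {n : ℕ} (v : Fin n → E) (x u : Fin n → ℝ) (δ : ℝ) :
    bfV v (fun j => x j + δ * u j) = bfV v x + δ • bfV v u := by
  unfold bfV
  rw [Finset.smul_sum, ← Finset.sum_add_distrib]
  exact Finset.sum_congr rfl fun j _ => by rw [add_smul, mul_smul]

lemma bf_pot_eq {y δ : ℝ} (h1 : -1 ≤ y + δ) (h2 : y + δ ≤ 1) (c N a : ℝ) :
    Real.exp (c + δ * a + N / 2 - bfH (y + δ) a)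
      = Real.exp (c + N / 2 - a ^ 2 / 2 - y * a) * bfC y a
        + δ * (Real.exp (c + N / 2 - a ^ 2 / 2 - y * a) * Real.sinh a) := by
  rw [sub_eq_add_neg, Real.exp_add, bfH_exp h1 h2]
  have : Real.exp (c + δ * a + N / 2) * (bfC (y + δ) a * Real.exp (-a ^ 2 / 2 - (y + δ) * a))
      = bfC (y + δ) a * Real.exp (c + N / 2 - a ^ 2 / 2 - y * a) := by
    rw [mul_left_comm, ← Real.exp_add]
    congr 2
    ring
  rw [this]
  unfold bfC
  ring

lemma bf_walk {n : ℕ} {κ : Type*} [Fintype κ] (v : Fin n → E) (hv : ∀ j, ‖v j‖ ≤ 1)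
    (θ : κ → E) (k : ℕ) :
    ∀ x : Fin n → ℝ, (∀ j, -1 ≤ x j ∧ x j ≤ 1) → (bfAlive x).card = k →
      ∀ p ∈ bfAlive x, ∃ z : Fin n → ℝ, (∀ j, z j = 1 ∨ z j = -1) ∧
        ∑ i, Real.exp (inner ℝ (θ i) (bfV v z)) ≤
          ∑ i, Real.exp (inner ℝ (θ i) (bfV v x) + bfN (bfS v (bfAlive x)) (θ i) / 2
            - bfH (x p) (inner ℝ (θ i) (bfW (bfS v ((bfAlive x).erase p)) (v p)))) := by
  induction k using Nat.strong_induction_on with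
  | _ k ih =>
  intro x hx hk p hp
  obtain ⟨u, hup, hu0, huV⟩ := bf_dir v (bfAlive x) p hp
  set W := bfS v ((bfAlive x).erase p) with hW
  set U := bfS v (bfAlive x) with hU
  set w := bfW W (v p) with hw
  set s := ∑ i, Real.exp (inner ℝ (θ i) (bfV v x) + bfN U (θ i) / 2
    - (inner ℝ (θ i) w) ^ 2 / 2 - x p * inner ℝ (θ i) w) * Real.sinh (inner ℝ (θ i) w) with hs
  obtain ⟨d, hxd, hsub, hds⟩ : ∃ d : ℝ, (∀ j, -1 ≤ x j + d * u j ∧ x j + d * u j ≤ 1) ∧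
      bfAlive (fun j => x j + d * u j) ⊂ bfAlive x ∧ d * s ≤ 0 := by
    rcases le_total s 0 with h | h
    · obtain ⟨δ, h0, h1, h2⟩ := bf_ray x u hx hu0 p (by rw [hup]; norm_num)
      exact ⟨δ, h1, h2, mul_nonpos_of_nonneg_of_nonpos h0 h⟩
    · obtain ⟨δ, h0, h1, h2⟩ := bf_ray x (fun j => - u j) hx (fun j hj => by simp [hu0 j hj]) p
        (by rw [hup]; norm_num)
      refine ⟨-δ, ?_, ?_, by nlinarith⟩
      · simpa using h1
      · simpa using h2
  set x' : Fin n → ℝ := fun j => x j + d * u j with hx'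
  have hx'p : x' p = x p + d := by simp [hx', hup]
  have hVx' : ∀ i, inner ℝ (θ i) (bfV v x') = inner ℝ (θ i) (bfV v x) + d * inner ℝ (θ i) w := by
    intro i
    rw [hx', bfV_add, huV, inner_add_right, inner_smul_right]
  have hpot : ∑ i, Real.exp (inner ℝ (θ i) (bfV v x') + bfN U (θ i) / 2
        - bfH (x' p) (inner ℝ (θ i) w)) ≤
      ∑ i, Real.exp (inner ℝ (θ i) (bfV v x) + bfN U (θ i) / 2 - bfH (x p) (inner ℝ (θ i) w)) := by
    have e1 : ∀ i, Real.exp (inner ℝ (θ i) (bfV v x') + bfN U (θ i) / 2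
        - bfH (x' p) (inner ℝ (θ i) w)) =
        Real.exp (inner ℝ (θ i) (bfV v x) + bfN U (θ i) / 2
          - (inner ℝ (θ i) w) ^ 2 / 2 - x p * inner ℝ (θ i) w) * bfC (x p) (inner ℝ (θ i) w)
        + d * (Real.exp (inner ℝ (θ i) (bfV v x) + bfN U (θ i) / 2
          - (inner ℝ (θ i) w) ^ 2 / 2 - x p * inner ℝ (θ i) w)
            * Real.sinh (inner ℝ (θ i) w)) := fun i => by
      rw [hVx', hx'p]
      exact bf_pot_eq (by rw [← hx'p]; exact (hxd p).1) (by rw [← hx'p]; exact (hxd p).2) _ _ _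
    have e0 : ∀ i, Real.exp (inner ℝ (θ i) (bfV v x) + bfN U (θ i) / 2
        - bfH (x p) (inner ℝ (θ i) w)) = _ := fun i => by
      have := bf_pot_eq (y := x p) (δ := 0) (by simpa using (hx p).1) (by simpa using (hx p).2)
        (inner ℝ (θ i) (bfV v x)) (bfN U (θ i)) (inner ℝ (θ i) w)
      simpa only [zero_mul, add_zero] using this
    rw [Finset.sum_congr rfl fun i _ => e1 i, Finset.sum_congr rfl fun i _ => e0 i,
      Finset.sum_add_distrib, ← Finset.mul_sum]
    linarith
  have hcard : (bfAlive x').card < k := hk ▸ Finset.card_lt_card hsub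
  by_cases hp' : p ∈ bfAlive x'
  · obtain ⟨z, hz, hzle⟩ := ih _ hcard x' hxd rfl p hp'
    refine ⟨z, hz, hzle.trans (le_trans ?_ hpot)⟩
    refine Finset.sum_le_sum fun i _ => Real.exp_le_exp.2 ?_
    have := bf_freeze W (bfS v ((bfAlive x').erase p)) U (bfS v (bfAlive x')) (v p) (θ i) (hv p)
      (bfS_mono v (Finset.erase_subset_erase p hsub.1)) (bfS_erase v hp) (bfS_erase v hp')
      (hxd p).1 (hxd p).2
    simp only [← hw] at this
    change _ - bfH (x' p) _ ≤ _ - bfH (x' p) _ at this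
    linarith
  · have hone : ∀ a, bfH (x' p) a = a ^ 2 / 2 := by
      intro a
      rw [mem_bfAlive] at hp'
      by_cases h : x' p = 1
      · rw [h, bfH_one]
      · have : x' p = -1 := by tauto
        rw [this, bfH_neg_one]
    have hle : ∑ i, Real.exp (inner ℝ (θ i) (bfV v x') + bfN (bfS v (bfAlive x')) (θ i) / 2) ≤
        ∑ i, Real.exp (inner ℝ (θ i) (bfV v x) + bfN U (θ i) / 2
          - bfH (x p) (inner ℝ (θ i) w)) := by
      refine le_trans ?_ hpot
      refine Finset.sum_le_sum fun i _ => Real.exp_le_exp.2 ?_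
      rw [hone]
      have h1 := bf_end W U (bfS_mono v (Finset.erase_subset _ _)) (v p) (θ i) (hv p)
        (Submodule.subset_span ⟨p, by exact_mod_cast hp, rfl⟩)
      have h2 : bfN (bfS v (bfAlive x')) (θ i) ≤ bfN W (θ i) := by
        apply bfN_mono
        apply bfS_mono
        exact Finset.subset_erase.2 ⟨hsub.1, hp'⟩
      rw [← hw] at h1
      linarith
    rcases (bfAlive x').eq_empty_or_nonempty with hemp | ⟨q, hq⟩
    · refine ⟨x', ?_, le_trans ?_ hle⟩
      · intro j
        have : j ∉ bfAlive x' := by simp [hemp]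
        rw [mem_bfAlive] at this
        tauto
      · refine Finset.sum_le_sum fun i _ => Real.exp_le_exp.2 ?_
        have := bfN_nonneg (bfS v (bfAlive x')) (θ i)
        linarith
    · obtain ⟨z, hz, hzle⟩ := ih _ hcard x' hxd rfl q hq
      refine ⟨z, hz, hzle.trans (le_trans ?_ hle)⟩
      refine Finset.sum_le_sum fun i _ => Real.exp_le_exp.2 ?_
      have := bfH_nonneg (hxd q).1 (hxd q).2
        (inner ℝ (θ i) (bfW (bfS v ((bfAlive x').erase q)) (v q)))
      change 0 ≤ bfH (x' q) _ at this
      linarith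

lemma bf_main {n : ℕ} (hn : 0 < n) {κ : Type*} [Fintype κ] (v : Fin n → E) (hv : ∀ j, ‖v j‖ ≤ 1)
    (θ : κ → E) :
    ∃ z : Fin n → ℝ, (∀ j, z j = 1 ∨ z j = -1) ∧
        ∑ i, Real.exp (inner ℝ (θ i) (bfV v z)) ≤ ∑ i, Real.exp (‖θ i‖ ^ 2 / 2) := by
  obtain ⟨z, hz, hle⟩ := bf_walk v hv θ _ (fun _ => 0) (fun _ => by norm_num) rfl ⟨0, hn⟩
    (by rw [mem_bfAlive]; norm_num)
  refine ⟨z, hz, hle.trans (Finset.sum_le_sum fun i _ => Real.exp_le_exp.2 ?_)⟩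
  have h1 := bfH_nonneg (y := 0) (by norm_num) (by norm_num) (inner ℝ (θ i)
    (bfW (bfS v ((bfAlive fun _ : Fin n => (0 : ℝ)).erase ⟨0, hn⟩)) (v ⟨0, hn⟩)))
  have h2 := bfN_le (bfS v (bfAlive fun _ : Fin n => (0 : ℝ))) (θ i)
  have h3 : bfV v (fun _ => 0) = 0 := by simp [bfV]
  rw [h3, inner_zero_right]
  linarith

end walk

theorem stmt_6 :
    ∃ C : ℝ, 0 < C ∧
      ∀ (m n t : ℕ), 2 ≤ n →
        ∀ S : Fin m → Finset (Fin n),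
          (∀ j : Fin n, (Finset.univ.filter fun i => j ∈ S i).card ≤ t) →
          ∃ x : Fin n → ℝ,
            (∀ j, x j = 1 ∨ x j = -1) ∧
            ∀ i, |∑ j ∈ S i, x j| ≤ C * Real.sqrt ((t : ℝ) * Real.log n) := by
  refine ⟨5, by norm_num, ?_⟩
  intro m n t hn S hS
  have hn' : (2 : ℝ) ≤ n := by exact_mod_cast hn
  have hlog2 : Real.log 2 ≤ Real.log n := Real.log_le_log (by norm_num) hn'
  have hlog : (0.69 : ℝ) < Real.log n := by
    have := Real.log_two_gt_d9
    linarith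
  by_cases ht : n ^ 2 ≤ t
  · -- trivial range
    refine ⟨fun _ => 1, fun _ => Or.inl rfl, fun i => ?_⟩
    have h1 : |∑ j ∈ S i, (1 : ℝ)| ≤ n := by
      simp only [Finset.sum_const, nsmul_eq_mul, mul_one, Nat.abs_cast]
      have := Finset.card_le_univ (S i)
      simp only [Fintype.card_fin] at this
      exact_mod_cast this
    have h2 : (n : ℝ) ^ 2 ≤ t := by exact_mod_cast ht
    have h3 : (n : ℝ) / 5 ≤ Real.sqrt ((t : ℝ) * Real.log n) := by
      apply Real.le_sqrt_of_sq_le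
      nlinarith
    linarith
  push Not at ht
  rcases Nat.eq_zero_or_pos t with ht0 | ht0
  · subst ht0
    refine ⟨fun _ => 1, fun _ => Or.inl rfl, fun i => ?_⟩
    have : S i = ∅ := by
      rw [Finset.eq_empty_iff_forall_notMem]
      intro j hj
      have := hS j
      rw [Nat.le_zero, Finset.card_eq_zero] at this
      have h2 : i ∈ (Finset.univ.filter fun i => j ∈ S i) := by simpa using hj
      rw [this] at h2
      simp at h2
    simp [this]
  -- main range
  have htR : (0 : ℝ) < t := by exact_mod_cast ht0
  set T := Real.sqrt t with hT
  have hT0 : 0 < T := Real.sqrt_pos.2 htR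
  have hTT : T ^ 2 = t := Real.sq_sqrt htR.le
  set l := Real.sqrt (Real.log n) with hl
  have hl0 : 0 < l := Real.sqrt_pos.2 (by linarith)
  have hll : l ^ 2 = Real.log n := Real.sq_sqrt (by linarith)
  let v : Fin n → EuclideanSpace ℝ (Fin m) := fun j =>
    WithLp.toLp 2 fun i => if j ∈ S i then 1 / T else 0
  have hv : ∀ j, ‖v j‖ ≤ 1 := by
    intro j
    rw [EuclideanSpace.norm_eq, Real.sqrt_le_one]
    have : ∀ i, ‖v j i‖ ^ 2 = if j ∈ S i then 1 / (t : ℝ) else 0 := by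
      intro i
      simp only [v]
      split_ifs
      · rw [Real.norm_eq_abs, sq_abs, div_pow, hTT, one_pow]
      · simp
    rw [Finset.sum_congr rfl fun i _ => this i, ← Finset.sum_filter, Finset.sum_const,
      nsmul_eq_mul, mul_one_div, div_le_one htR]
    exact_mod_cast hS j
  let I : Finset (Fin m) := Finset.univ.filter fun i => (S i).Nonempty
  have hI : (I.card : ℝ) ≤ n ^ 3 := by
    have h1 : I.card ≤ n * t := by
      calc I.card ≤ ∑ i ∈ I, (S i).card := by
            rw [Finset.card_eq_sum_ones]
            refine Finset.sum_le_sum fun i hi => ?_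
            exact Finset.card_pos.2 (Finset.mem_filter.1 hi).2
        _ ≤ ∑ i, (S i).card := Finset.sum_le_sum_of_subset (Finset.subset_univ _)
        _ = ∑ j, (Finset.univ.filter fun i => j ∈ S i).card := by
            simp only [Finset.card_filter]
            rw [Finset.sum_comm]
            simp
        _ ≤ ∑ j : Fin n, t := Finset.sum_le_sum fun j _ => hS j
        _ = n * t := by simp
    have h2 : I.card ≤ n ^ 3 := by nlinarith
    exact_mod_cast h2
  let θ : (I × Bool) → EuclideanSpace ℝ (Fin m) := fun k =>
    (if k.2 then l else -l) • EuclideanSpace.single (k.1 : Fin m) (1 : ℝ)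
  obtain ⟨x, hx, hle⟩ := bf_main (by omega) v hv θ
  refine ⟨x, hx, fun i => ?_⟩
  have hsq : Real.sqrt ((t : ℝ) * Real.log n) = T * l := Real.sqrt_mul htR.le _
  rw [hsq]
  by_cases hi : i ∈ I
  swap
  · have : S i = ∅ := by simpa [I] using hi
    rw [this]
    simp only [Finset.sum_empty, abs_zero]
    positivity
  have hθn : ∀ k, ‖θ k‖ ^ 2 = l ^ 2 := by
    intro k
    simp only [θ, norm_smul, EuclideanSpace.norm_single, norm_one, mul_one]
    split_ifs <;> simp
  have hinner : ∀ b : Bool, inner ℝ (θ (⟨i, hi⟩, b)) (bfV v x)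
      = (if b then l else -l) * ((∑ j ∈ S i, x j) / T) := by
    intro b
    simp only [θ, inner_smul_left, EuclideanSpace.inner_single_left]
    simp [bfV, v, Finset.sum_mul, div_eq_mul_inv]
  have hR : ∑ k, Real.exp (‖θ k‖ ^ 2 / 2) ≤ Real.exp (4 * l ^ 2 + l ^ 2 / 2) := by
    simp only [hθn, Finset.sum_const, Finset.card_univ, nsmul_eq_mul, Fintype.card_prod,
      Fintype.card_coe, Fintype.card_bool]
    rw [Real.exp_add]
    gcongr
    have : Real.exp (4 * l ^ 2) = n ^ 4 := by
      rw [hll, show (4 : ℝ) * Real.log n = ((4 : ℕ) : ℝ) * Real.log n by norm_num,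
        Real.exp_nat_mul, Real.exp_log (by linarith)]
    rw [this]
    push_cast
    have : (0 : ℝ) ≤ (n : ℝ) ^ 3 := by positivity
    nlinarith
  have hb : ∀ b : Bool, (if b then l else -l) * ((∑ j ∈ S i, x j) / T) ≤ 4 * l ^ 2 + l ^ 2 / 2 := by
    intro b
    rw [← hinner, ← Real.exp_le_exp]
    refine le_trans ?_ (hle.trans hR)
    exact Finset.single_le_sum (f := fun k => Real.exp (inner ℝ (θ k) (bfV v x)))
      (fun k _ => (Real.exp_pos _).le) (Finset.mem_univ ((⟨i, hi⟩, b) : I × Bool))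
  have hb1 := hb true
  have hb2 := hb false
  simp only [if_true, Bool.false_eq_true, if_false] at hb1 hb2
  set X := ∑ j ∈ S i, x j with hX
  have hXT : X = (X / T) * T := by field_simp
  have a1 : X / T ≤ 5 * l := by
    by_contra h
    push Not at h
    nlinarith
  have a2 : - (X / T) ≤ 5 * l := by
    by_contra h
    push Not at h
    nlinarith
  rw [abs_le]
  constructor <;> nlinarith
end
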